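/- In a co-Frobenius coquasitriangular Hopf algebra one has u⁻¹ * v = v * u⁻¹ = α * β_a = α * α_a in H*; explicitly, the convolution products of u⁻¹(h) = σ(S²(h₂) ⊗ h₁) with v(h) = σ(h₁ ⊗ S(h₂)) (in either order) equal both α * (h ↦ σ(a ⊗ h)) and α * (h ↦ σ(h ⊗ a⁻¹)). -/

import Mathlib

open TensorProduct Coalgebra HopfAlgebra

variable {k H : Type*} [Field k] [Ring H] [HopfAlgebra k H]

/-- The antipode of `H`, as a linear map. -/
local notation "𝐒" => HopfAlgebra.antipode (R := k)

/-- Convolution product on the dual of `H`: `(conv f g) h = f h₁ * g h₂`. -/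
noncomputable def conv (f g : H →ₗ[k] k) : H →ₗ[k] k :=
  (LinearMap.mul' k k) ∘ₗ (TensorProduct.map f g) ∘ₗ (Coalgebra.comul (R := k))

/-- `h ↦ f h₁ • h₂`. -/
noncomputable def lT (f : H →ₗ[k] k) : H →ₗ[k] H :=
  (TensorProduct.lid k H).toLinearMap ∘ₗ (f.rTensor H) ∘ₗ (Coalgebra.comul (R := k))

/-- The Sweedler sum `h ↦ f h₁ • p h₃ • g h₂`. -/
noncomputable def sw3 (f : H →ₗ[k] k) (g : H →ₗ[k] H) (p : H →ₗ[k] k) : H →ₗ[k] H :=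
  (TensorProduct.lid k H).toLinearMap
    ∘ₗ (TensorProduct.rid k (k ⊗[k] H)).toLinearMap
    ∘ₗ (TensorProduct.map (TensorProduct.map f g) p)
    ∘ₗ ((Coalgebra.comul (R := k)).rTensor H)
    ∘ₗ (Coalgebra.comul (R := k))

/-- `χ(h) = α(h₂) • S⁻²(h₁)`, the generalized Nakayama automorphism. -/
noncomputable def chiMap (Sinv : H →ₗ[k] H) (f : H →ₗ[k] k) : H →ₗ[k] H :=
  (TensorProduct.rid k H).toLinearMap
    ∘ₗ (TensorProduct.map (Sinv ∘ₗ Sinv) f)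
    ∘ₗ (Coalgebra.comul (R := k))

/-- `f(R¹) • R²` for `R = R¹ ⊗ R² ∈ H ⊗ H`. -/
noncomputable def lap (f : H →ₗ[k] k) : (H ⊗[k] H) →ₗ[k] H :=
  (TensorProduct.lid k H).toLinearMap ∘ₗ (f.rTensor H)

/-- `f(R²) • R¹` for `R = R¹ ⊗ R² ∈ H ⊗ H`. -/
noncomputable def rap (f : H →ₗ[k] k) : (H ⊗[k] H) →ₗ[k] H :=
  (TensorProduct.rid k H).toLinearMap ∘ₗ (LinearMap.lTensor H f)

/-- The Drinfeld element `u = S(R²)R¹`. -/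
noncomputable def uElt (Rm : H ⊗[k] H) : H :=
  (LinearMap.mul' k H)
    ((TensorProduct.comm k H H)
      ((LinearMap.lTensor H (HopfAlgebra.antipode (R := k))) Rm))

/-- Convolution product on the dual of `H ⊗ H`. -/
noncomputable def conv2 (f g : (H ⊗[k] H) →ₗ[k] k) : (H ⊗[k] H) →ₗ[k] k :=
  (LinearMap.mul' k k) ∘ₗ (TensorProduct.map f g) ∘ₗ (Coalgebra.comul (R := k) (A := H ⊗[k] H))

/-- `(h ⊗ l) ↦ σ(h₂ ⊗ l₂) • (l₁ * h₁)`. -/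
noncomputable def ac1 (σ : (H ⊗[k] H) →ₗ[k] k) : (H ⊗[k] H) →ₗ[k] H :=
  (TensorProduct.rid k H).toLinearMap
    ∘ₗ (TensorProduct.map ((LinearMap.mul' k H) ∘ₗ (TensorProduct.comm k H H).toLinearMap) σ)
    ∘ₗ (TensorProduct.tensorTensorTensorComm k H H H H).toLinearMap
    ∘ₗ (TensorProduct.map (Coalgebra.comul (R := k)) (Coalgebra.comul (R := k)))

/-- `(h ⊗ l) ↦ σ(h₁ ⊗ l₁) • (h₂ * l₂)`. -/
noncomputable def ac2 (σ : (H ⊗[k] H) →ₗ[k] k) : (H ⊗[k] H) →ₗ[k] H :=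
  (TensorProduct.lid k H).toLinearMap
    ∘ₗ (TensorProduct.map σ (LinearMap.mul' k H))
    ∘ₗ (TensorProduct.tensorTensorTensorComm k H H H H).toLinearMap
    ∘ₗ (TensorProduct.map (Coalgebra.comul (R := k)) (Coalgebra.comul (R := k)))

/-- `(h ⊗ l) ↦ ρ(h₁ ⊗ l₁) * lam(h₂ * l₂) * τ(h₃ ⊗ l₃)`. -/
noncomputable def trip (lam : H →ₗ[k] k) (ρ τ : (H ⊗[k] H) →ₗ[k] k) : (H ⊗[k] H) →ₗ[k] k :=
  (LinearMap.mul' k k)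
    ∘ₗ ((LinearMap.mul' k k).rTensor k)
    ∘ₗ (TensorProduct.map (TensorProduct.map ρ (lam ∘ₗ (LinearMap.mul' k H))) τ)
    ∘ₗ ((TensorProduct.tensorTensorTensorComm k H H H H).toLinearMap.rTensor (H ⊗[k] H))
    ∘ₗ (TensorProduct.tensorTensorTensorComm k (H ⊗[k] H) H (H ⊗[k] H) H).toLinearMap
    ∘ₗ (TensorProduct.map
          (((Coalgebra.comul (R := k)).rTensor H) ∘ₗ (Coalgebra.comul (R := k)))
          (((Coalgebra.comul (R := k)).rTensor H) ∘ₗ (Coalgebra.comul (R := k))))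

/-- `u(h) = σ(h₂ ⊗ S h₁)`. -/
noncomputable def uF (σ : (H ⊗[k] H) →ₗ[k] k) : H →ₗ[k] k :=
  σ ∘ₗ (TensorProduct.comm k H H).toLinearMap
    ∘ₗ ((HopfAlgebra.antipode (R := k)).rTensor H) ∘ₗ (Coalgebra.comul (R := k))

/-- `v(h) = σ(h₁ ⊗ S h₂)`. -/
noncomputable def vF (σ : (H ⊗[k] H) →ₗ[k] k) : H →ₗ[k] k :=
  σ ∘ₗ (LinearMap.lTensor H (HopfAlgebra.antipode (R := k))) ∘ₗ (Coalgebra.comul (R := k))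

/-- `u⁻¹(h) = σ(S²(h₂) ⊗ h₁)`. -/
noncomputable def uinvF (σ : (H ⊗[k] H) →ₗ[k] k) : H →ₗ[k] k :=
  σ ∘ₗ (((HopfAlgebra.antipode (R := k)) ∘ₗ (HopfAlgebra.antipode (R := k))).rTensor H)
    ∘ₗ (TensorProduct.comm k H H).toLinearMap ∘ₗ (Coalgebra.comul (R := k))

/-- `v⁻¹(h) = σ(S²(h₁) ⊗ h₂)`. -/
noncomputable def vinvF (σ : (H ⊗[k] H) →ₗ[k] k) : H →ₗ[k] k :=
  σ ∘ₗ (((HopfAlgebra.antipode (R := k)) ∘ₗ (HopfAlgebra.antipode (R := k))).rTensor H)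
    ∘ₗ (Coalgebra.comul (R := k))

section Sweedler

open LinearMap WithConv

theorem conv_eq_sum (f g : H →ₗ[k] k) (h : H) :
    conv f g h = ∑ i ∈ (ℛ k h).index, f ((ℛ k h).left i) * g ((ℛ k h).right i) := by
  simp [conv, ← (ℛ k h).eq]

theorem lT_eq_sum (f : H →ₗ[k] k) (h : H) :
    lT f h = ∑ i ∈ (ℛ k h).index, f ((ℛ k h).left i) • (ℛ k h).right i := by
  simp [lT, ← (ℛ k h).eq]

/-- `h ↦ f h₂ • h₁`. -/
noncomputable def rT (f : H →ₗ[k] k) : H →ₗ[k] H :=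
  (TensorProduct.rid k H).toLinearMap ∘ₗ (f.lTensor H) ∘ₗ (Coalgebra.comul (R := k))

theorem rT_eq_sum (f : H →ₗ[k] k) (h : H) :
    rT f h = ∑ i ∈ (ℛ k h).index, f ((ℛ k h).right i) • (ℛ k h).left i := by
  simp [rT, ← (ℛ k h).eq]

theorem sum_coassoc {M : Type*} [AddCommGroup M] [Module k M] (Φ : H ⊗[k] (H ⊗[k] H) →ₗ[k] M)
    (h : H) :
    ∑ i ∈ (ℛ k h).index, ∑ j ∈ (ℛ k ((ℛ k h).left i)).index,
        Φ ((ℛ k ((ℛ k h).left i)).left j ⊗ₜ ((ℛ k ((ℛ k h).left i)).right j ⊗ₜ (ℛ k h).right i)) =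
      ∑ i ∈ (ℛ k h).index, ∑ j ∈ (ℛ k ((ℛ k h).right i)).index,
        Φ ((ℛ k h).left i ⊗ₜ
          ((ℛ k ((ℛ k h).right i)).left j ⊗ₜ (ℛ k ((ℛ k h).right i)).right j)) := by
  simpa only [map_sum] using congrArg Φ (Coalgebra.sum_tmul_tmul_eq (ℛ k h)
    (fun i => ℛ k ((ℛ k h).left i)) (fun i => ℛ k ((ℛ k h).right i)))

theorem mul_sum_eq (h l : H) {M : Type*} [AddCommGroup M] [Module k M] (Φ : H ⊗[k] H →ₗ[k] M) :
    Φ (comul (R := k) (h * l)) =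
      ∑ i ∈ (ℛ k h).index, ∑ j ∈ (ℛ k l).index,
        Φ (((ℛ k h).left i * (ℛ k l).left j) ⊗ₜ ((ℛ k h).right i * (ℛ k l).right j)) := by
  rw [Bialgebra.comul_mul, ← (ℛ k h).eq, ← (ℛ k l).eq]
  simp [Finset.sum_mul_sum]

theorem convMul_tmul_apply {A : Type*} [Ring A] [Algebra k A]
    (f g : WithConv (H ⊗[k] H →ₗ[k] A)) (h l : H) :
    (f * g) (h ⊗ₜ l) = ∑ i ∈ (ℛ k h).index, ∑ j ∈ (ℛ k l).index,
      f ((ℛ k h).left i ⊗ₜ (ℛ k l).left j) * g ((ℛ k h).right i ⊗ₜ (ℛ k l).right j) := by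
  rw [LinearMap.convMul_apply, TensorProduct.comul_tmul, ← (ℛ k h).eq, ← (ℛ k l).eq]
  simp only [TensorProduct.sum_tmul, TensorProduct.tmul_sum, map_sum,
    TensorProduct.AlgebraTensorModule.tensorTensorTensorComm_tmul, TensorProduct.map_tmul,
    LinearMap.mul'_apply]
  exact Finset.sum_comm

theorem antipode_convMul_mulRight (z : H) :
    toConv 𝐒 * toConv (mulRight k z) = toConv ((toSpanSingleton k H z) ∘ₗ counit) := by
  ext x
  have := congrArg (· * z) (HopfAlgebra.sum_antipode_mul_eq_smul (ℛ k x))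
  simp only [Finset.sum_mul, mul_assoc, smul_mul_assoc, one_mul] at this
  rw [(ℛ k x).convMul_apply]
  simpa using this

theorem mulLeft_convMul_antipode (z : H) :
    toConv (mulLeft k z) * toConv 𝐒 = toConv ((toSpanSingleton k H z) ∘ₗ counit) := by
  ext x
  have := congrArg (z * ·) (HopfAlgebra.sum_mul_antipode_eq_smul (ℛ k x))
  simp only [Finset.mul_sum, ← mul_assoc, mul_smul_comm, mul_one] at this
  rw [(ℛ k x).convMul_apply]
  simpa using this

theorem counit_convMul_linearMap (z : H) (f : H →ₗ[k] k) :
    toConv ((toSpanSingleton k H z) ∘ₗ counit) * toConv (Algebra.linearMap k H ∘ₗ f) =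
      toConv ((toSpanSingleton k H z) ∘ₗ f) := by
  ext x
  rw [(ℛ k x).convMul_apply]
  have := congrArg (fun y => f y • z) (Coalgebra.sum_counit_smul (ℛ k x))
  simp only [map_sum, map_smul, Finset.sum_smul, smul_eq_mul] at this
  simpa [Algebra.algebraMap_eq_smul_one, smul_smul, mul_comm] using this

theorem linearMap_convMul_counit (z : H) (f : H →ₗ[k] k) :
    toConv (Algebra.linearMap k H ∘ₗ f) * toConv ((toSpanSingleton k H z) ∘ₗ counit) =
      toConv ((toSpanSingleton k H z) ∘ₗ f) := by
  ext x
  rw [(ℛ k x).convMul_apply]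
  have := congrArg (fun y : WithConv (H →ₗ[k] k) => y x • z) (mul_one (toConv f))
  simp only [(ℛ k x).convMul_apply, Finset.sum_smul] at this
  simpa [Algebra.algebraMap_eq_smul_one, smul_smul, mul_comm] using this

/-- If `h₁ λ(h₂) = λ(h)`, then `λ(h l₂) l₁ = λ(h₂ l) S(h₁)`. -/
theorem rT_mul_left (lam : H →ₗ[k] k) (hlam : ∀ h : H, rT lam h = lam h • (1 : H)) (h l : H) :
    rT (lam ∘ₗ mulLeft k h) l =
      ∑ i ∈ (ℛ k h).index, lam ((ℛ k h).right i * l) • 𝐒 ((ℛ k h).left i) := by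
  let E : WithConv (H →ₗ[k] H) := toConv (Algebra.linearMap k H ∘ₗ lam ∘ₗ mulRight k l)
  have hE : E = ∑ j ∈ (ℛ k l).index, toConv (mulRight k ((ℛ k l).left j)) *
      toConv (Algebra.linearMap k H ∘ₗ lam ∘ₗ mulRight k ((ℛ k l).right j)) := by
    ext x
    have h1 := mul_sum_eq x l ((TensorProduct.rid k H).toLinearMap ∘ₗ (lam.lTensor H))
    have h2 := hlam (x * l)
    simp only [rT, LinearMap.comp_apply] at h2 h1
    rw [h2] at h1
    simp only [ofConv_sum, LinearMap.sum_apply, (ℛ k x).convMul_apply]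
    rw [Finset.sum_comm]
    simpa [E, Algebra.algebraMap_eq_smul_one] using h1
  have key : toConv 𝐒 * E = ∑ j ∈ (ℛ k l).index,
      toConv (toSpanSingleton k H ((ℛ k l).left j) ∘ₗ lam ∘ₗ mulRight k ((ℛ k l).right j)) := by
    rw [hE, Finset.mul_sum]
    simp only [← mul_assoc, antipode_convMul_mulRight, counit_convMul_linearMap]
  have := congrArg (fun f : WithConv (H →ₗ[k] H) => f h) key
  simp only [(ℛ k h).convMul_apply, ofConv_sum, LinearMap.sum_apply] at this
  rw [rT_eq_sum]
  simpa [E, Algebra.algebraMap_eq_smul_one] using this.symm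

/-- If `λ(h₁) h₂ = λ(h) g`, then `λ(h₁ l) h₂ = λ(h l₁) g S(l₂)`. -/
theorem lT_mul_right (lam : H →ₗ[k] k) (g : H) (hlam : ∀ h : H, lT lam h = lam h • g) (h l : H) :
    lT (lam ∘ₗ mulRight k l) h =
      ∑ i ∈ (ℛ k l).index, lam (h * (ℛ k l).left i) • (g * 𝐒 ((ℛ k l).right i)) := by
  let E : WithConv (H →ₗ[k] H) := toConv (toSpanSingleton k H g ∘ₗ lam ∘ₗ mulLeft k h)
  have hE : E = ∑ j ∈ (ℛ k h).index,
      toConv (Algebra.linearMap k H ∘ₗ lam ∘ₗ mulLeft k ((ℛ k h).left j)) *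
        toConv (mulLeft k ((ℛ k h).right j)) := by
    ext x
    have h1 := mul_sum_eq h x ((TensorProduct.lid k H).toLinearMap ∘ₗ (lam.rTensor H))
    have h2 := hlam (h * x)
    simp only [lT, LinearMap.comp_apply] at h2 h1
    rw [h2] at h1
    simp only [ofConv_sum, LinearMap.sum_apply, (ℛ k x).convMul_apply]
    simpa [E, Algebra.algebraMap_eq_smul_one] using h1
  have key : E * toConv 𝐒 = ∑ j ∈ (ℛ k h).index,
      toConv (toSpanSingleton k H ((ℛ k h).right j) ∘ₗ lam ∘ₗ mulLeft k ((ℛ k h).left j)) := by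
    rw [hE, Finset.sum_mul]
    simp only [mul_assoc, mulLeft_convMul_antipode, linearMap_convMul_counit]
  have := congrArg (fun f : WithConv (H →ₗ[k] H) => f l) key
  simp only [(ℛ k l).convMul_apply, ofConv_sum, LinearMap.sum_apply] at this
  rw [lT_eq_sum]
  simpa [E] using this.symm

/-- `λ(xl) = 0` for all `l` forces `ε(x) = 0`. -/
theorem counit_eq_zero_of_mul_right (lam : H →ₗ[k] k) (hne : lam ≠ 0) (g : H)
    (hlam : ∀ h : H, lT lam h = lam h • g) (x : H) (hx : ∀ l, lam (x * l) = 0) :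
    counit (R := k) x = 0 := by
  have h0 : ∀ l, lT (lam ∘ₗ mulRight k l) x = 0 := fun l => by
    rw [lT_mul_right lam g hlam]
    simp [hx]
  have hN : ∀ (f : H →ₗ[k] k) (l : H), lam (rT f x * l) = 0 := fun f l => by
    have := congrArg f (h0 l)
    rw [lT_eq_sum, map_sum] at this
    rw [rT_eq_sum, Finset.sum_mul, map_sum]
    simpa [mul_comm] using this
  classical
  let b := Module.Basis.ofVectorSpace k H
  have hd : comul (R := k) x = (TensorProduct.equivFinsuppOfBasisRight b (comul (R := k) x)).sum
      fun i m => m ⊗ₜ b i := by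
    rw [← TensorProduct.equivFinsuppOfBasisRight_symm_apply, LinearEquiv.symm_apply_apply]
  have hc : ∀ i, TensorProduct.equivFinsuppOfBasisRight b (comul (R := k) x) i =
      rT (b.coord i) x := fun i => by
    rw [rT_eq_sum, ← (ℛ k x).eq]
    simp
  obtain ⟨l, hl⟩ : ∃ l, lam l ≠ 0 := by
    by_contra! h
    exact hne (LinearMap.ext h)
  have h1 := HopfAlgebra.mul_antipode_lTensor_comul_apply (R := k) x
  rw [hd] at h1
  simp only [Finsupp.sum, map_sum] at h1
  have h2 := congrArg (fun y => lam (y * l)) h1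
  simp only [LinearMap.lTensor_tmul, LinearMap.mul'_apply, hc, Finset.sum_mul, mul_assoc, map_sum,
    hN, Finset.sum_const_zero, Algebra.algebraMap_eq_smul_one, smul_mul_assoc, one_mul, map_smul,
    smul_eq_mul] at h2
  exact (mul_eq_zero.mp h2.symm).resolve_right hl

theorem ac1_eq_sum (σ : (H ⊗[k] H) →ₗ[k] k) (h l : H) :
    ac1 σ (h ⊗ₜ l) = ∑ i ∈ (ℛ k h).index, ∑ j ∈ (ℛ k l).index,
      σ ((ℛ k h).right i ⊗ₜ (ℛ k l).right j) • ((ℛ k l).left j * (ℛ k h).left i) := by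
  simp only [ac1, LinearMap.comp_apply, TensorProduct.map_tmul]
  rw [← (ℛ k h).eq, ← (ℛ k l).eq]
  simp [TensorProduct.sum_tmul, TensorProduct.tmul_sum]
  exact Finset.sum_comm

theorem ac2_eq_sum (σ : (H ⊗[k] H) →ₗ[k] k) (h l : H) :
    ac2 σ (h ⊗ₜ l) = ∑ i ∈ (ℛ k h).index, ∑ j ∈ (ℛ k l).index,
      σ ((ℛ k h).left i ⊗ₜ (ℛ k l).left j) • ((ℛ k h).right i * (ℛ k l).right j) := by
  simp only [ac2, LinearMap.comp_apply, TensorProduct.map_tmul]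
  rw [← (ℛ k h).eq, ← (ℛ k l).eq]
  simp [TensorProduct.sum_tmul, TensorProduct.tmul_sum]
  exact Finset.sum_comm

theorem uF_eq_sum (σ : (H ⊗[k] H) →ₗ[k] k) (h : H) :
    uF σ h = ∑ i ∈ (ℛ k h).index, σ ((ℛ k h).right i ⊗ₜ 𝐒 ((ℛ k h).left i)) := by
  simp only [uF, LinearMap.comp_apply]
  rw [← (ℛ k h).eq]
  simp

theorem vF_eq_sum (σ : (H ⊗[k] H) →ₗ[k] k) (h : H) :
    vF σ h = ∑ i ∈ (ℛ k h).index, σ ((ℛ k h).left i ⊗ₜ 𝐒 ((ℛ k h).right i)) := by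
  simp only [vF, LinearMap.comp_apply]
  rw [← (ℛ k h).eq]
  simp

theorem sum_sigma_lam (lam : H →ₗ[k] k) (hlam : ∀ h : H, rT lam h = lam h • (1 : H))
    (σ : (H ⊗[k] H) →ₗ[k] k) (h l : H) :
    lam (ac2 σ (h ⊗ₜ l)) = conv (vF σ) (lam ∘ₗ mulRight k l) h := by
  have h1 : lam (ac2 σ (h ⊗ₜ l)) = ∑ i ∈ (ℛ k h).index,
      σ ((ℛ k h).left i ⊗ₜ rT (lam ∘ₗ mulLeft k ((ℛ k h).right i)) l) := by
    rw [ac2_eq_sum]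
    simp [rT_eq_sum, TensorProduct.tmul_sum, mul_comm]
  simp only [h1, rT_mul_left lam hlam, conv_eq_sum, vF_eq_sum, TensorProduct.tmul_sum, map_sum]
  have := sum_coassoc (LinearMap.mul' k k ∘ₗ
    TensorProduct.map (σ ∘ₗ LinearMap.lTensor H 𝐒) (lam ∘ₗ mulRight k l) ∘ₗ
    (TensorProduct.assoc k H H H).symm.toLinearMap) h
  simp at this
  simpa [Finset.sum_mul, mul_comm, Finset.mul_sum] using this.symm

theorem sum_lam_sigma (lam : H →ₗ[k] k) (g : H) (hlam : ∀ h : H, lT lam h = lam h • g)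
    (σ : (H ⊗[k] H) →ₗ[k] k)
    (hσ2 : ∀ h l m : H, σ (h ⊗ₜ[k] (l * m)) =
      conv (σ ∘ₗ ((TensorProduct.mk k H H).flip m)) (σ ∘ₗ ((TensorProduct.mk k H H).flip l)) h)
    (h l : H) :
    lam (ac1 σ (h ⊗ₜ l)) = conv (lam ∘ₗ mulLeft k l)
      (conv (uF σ) (σ ∘ₗ ((TensorProduct.mk k H H).flip g))) h := by
  have h1 : lam (ac1 σ (h ⊗ₜ l)) = ∑ i ∈ (ℛ k h).index,
      σ ((ℛ k h).right i ⊗ₜ lT (lam ∘ₗ mulRight k ((ℛ k h).left i)) l) := by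
    rw [ac1_eq_sum]
    simp [lT_eq_sum, TensorProduct.tmul_sum, mul_comm]
  have h2 : ∀ y : H, conv (uF σ) (σ ∘ₗ ((TensorProduct.mk k H H).flip g)) y =
      ∑ i ∈ (ℛ k y).index, σ ((ℛ k y).right i ⊗ₜ (g * 𝐒 ((ℛ k y).left i))) := by
    intro y
    simp only [hσ2, conv_eq_sum, uF_eq_sum]
    have := sum_coassoc (LinearMap.mul' k k ∘ₗ
      TensorProduct.map (σ ∘ₗ (TensorProduct.comm k H H).toLinearMap ∘ₗ LinearMap.rTensor H 𝐒)
        (σ ∘ₗ ((TensorProduct.mk k H H).flip g)) ∘ₗ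
      (TensorProduct.assoc k H H H).symm.toLinearMap) y
    simp at this
    simp [Finset.sum_mul, this]
  rw [conv_eq_sum]
  simp only [h1, h2, lT_mul_right lam g hlam, TensorProduct.tmul_sum, map_sum]
  have := sum_coassoc (LinearMap.mul' k k ∘ₗ
    TensorProduct.map (lam ∘ₗ mulLeft k l)
      (σ ∘ₗ (TensorProduct.comm k H H).toLinearMap ∘ₗ
        LinearMap.rTensor H (mulLeft k g ∘ₗ 𝐒))) h
  simp at this
  simp [Finset.mul_sum, ← this]

theorem counit_chiMap (Sinv : H →ₗ[k] H) (hSinv : ∀ h : H, 𝐒 (Sinv h) = h) (f : H →ₗ[k] k)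
    (h : H) : counit (R := k) (chiMap Sinv f h) = f h := by
  have hc : ∀ y : H, counit (R := k) (Sinv y) = counit (R := k) y := fun y => by
    rw [← HopfAlgebra.counit_antipode, hSinv]
  have := congrArg f (Coalgebra.sum_counit_smul (ℛ k h))
  simp only [map_sum, map_smul, smul_eq_mul] at this
  rw [← this, chiMap, LinearMap.comp_apply, LinearMap.comp_apply, ← (ℛ k h).eq]
  simp [hc, mul_comm]

/-- The identity `v = α * u * σ(- ⊗ g)`. -/
theorem vF_eq_conv (lam : H →ₗ[k] k) (hne : lam ≠ 0)
    (hlam : ∀ h : H, rT lam h = lam h • (1 : H)) (g : H)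
    (hmod : ∀ h : H, lT lam h = lam h • g)
    (Sinv : H →ₗ[k] H) (hSinv : ∀ h : H, 𝐒 (Sinv h) = h) (α : H →ₗ[k] k)
    (hα : ∀ h l : H, lam (l * h) = lam ((chiMap Sinv α h) * l))
    (σ : (H ⊗[k] H) →ₗ[k] k)
    (hσ2 : ∀ h l m : H, σ (h ⊗ₜ[k] (l * m)) =
      conv (σ ∘ₗ ((TensorProduct.mk k H H).flip m)) (σ ∘ₗ ((TensorProduct.mk k H H).flip l)) h)
    (hσ4 : ∀ h l : H, ac1 σ (h ⊗ₜ[k] l) = ac2 σ (h ⊗ₜ[k] l)) :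
    vF σ = conv α (conv (uF σ) (σ ∘ₗ ((TensorProduct.mk k H H).flip g))) := by
  ext h
  set w := conv (uF σ) (σ ∘ₗ ((TensorProduct.mk k H H).flip g)) with hw
  have key := counit_eq_zero_of_mul_right lam hne g hmod
    (lT (vF σ) h - ∑ i ∈ (ℛ k h).index, w ((ℛ k h).right i) • chiMap Sinv α ((ℛ k h).left i))
    (fun l => by
      have h1 := sum_lam_sigma lam g hmod σ hσ2 h l
      rw [hσ4, sum_sigma_lam lam hlam, conv_eq_sum, conv_eq_sum, ← hw] at h1
      simp only [LinearMap.comp_apply, mulLeft_apply, mulRight_apply, hα _ l] at h1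
      rw [lT_eq_sum, sub_mul, map_sub, sub_eq_zero, Finset.sum_mul, Finset.sum_mul]
      simpa [mul_comm] using h1)
  rw [map_sub, sub_eq_zero, lT_eq_sum] at key
  simp only [map_sum, map_smul, counit_chiMap Sinv hSinv, smul_eq_mul] at key
  have h2 := congrArg (fun y : WithConv (H →ₗ[k] k) => y h) (mul_one (toConv (vF σ)))
  simp only [(ℛ k h).convMul_apply] at h2
  rw [conv_eq_sum]
  simp only [mul_comm (α _)]
  exact h2.symm.trans key

theorem rT_eq_smul_one (lam : H →ₗ[k] k)
    (hlam : ∀ f : H →ₗ[k] k, conv f lam = f 1 • lam) (h : H) : rT lam h = lam h • (1 : H) := by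
  rw [← sub_eq_zero, ← Module.forall_dual_apply_eq_zero_iff k]
  intro f
  have := LinearMap.congr_fun (hlam f) h
  rw [conv_eq_sum] at this
  rw [map_sub, sub_eq_zero, rT_eq_sum]
  simpa [mul_comm] using this

theorem apply_sw3 (f p q : H →ₗ[k] k) (h : H) :
    f (sw3 p LinearMap.id q h) = conv (conv p f) q h := by
  rw [conv_eq_sum]
  simp only [conv_eq_sum, sw3, LinearMap.comp_apply]
  rw [← (ℛ k h).eq]
  simp only [map_sum, LinearMap.rTensor_tmul]
  refine Finset.sum_congr rfl fun i _ => ?_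
  conv_lhs => rw [← (ℛ k ((ℛ k h).left i)).eq]
  simp [TensorProduct.sum_tmul, Finset.mul_sum, mul_comm]

theorem convMul_comm_of_antipode_sq (f p q : H →ₗ[k] k)
    (hS : ∀ h : H, 𝐒 (𝐒 h) = sw3 p LinearMap.id q h) (hqp : conv q p = Coalgebra.counit (R := k))
    (hf : ∀ h : H, f (𝐒 (𝐒 h)) = f h) :
    toConv f * toConv p = toConv p * toConv f := by
  have h1 : toConv f = toConv p * toConv f * toConv q := by
    ext h
    have := hf h
    rw [hS, apply_sw3] at this
    exact this.symm
  have h2 : toConv q * toConv p = 1 := congrArg toConv hqp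
  conv_lhs => rw [h1, mul_assoc, h2, mul_one]

/-- Characters are invariant under the square of the antipode. -/
theorem character_antipode_sq (f : H →ₗ[k] k) (h1 : f 1 = 1) (hm : ∀ x y, f (x * y) = f x * f y)
    (h : H) : f (𝐒 (𝐒 h)) = f h := by
  have e1 : toConv f * toConv (f ∘ₗ 𝐒) = 1 := by
    ext x
    rw [(ℛ k x).convMul_apply]
    have := congrArg f (HopfAlgebra.sum_mul_antipode_eq_smul (ℛ k x))
    simpa [hm, h1] using this
  have e2 : toConv (f ∘ₗ 𝐒 ∘ₗ 𝐒) * toConv (f ∘ₗ 𝐒) = 1 := by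
    ext x
    rw [(ℛ k x).convMul_apply]
    have := congrArg (fun y => f (𝐒 y)) (HopfAlgebra.sum_antipode_mul_eq_smul (ℛ k x))
    simpa [hm, h1, HopfAlgebra.antipode_mul_antidistrib, HopfAlgebra.antipode_one, mul_comm]
      using this
  have e3 : toConv (f ∘ₗ 𝐒) * toConv f = 1 := by
    ext x
    rw [(ℛ k x).convMul_apply]
    have := congrArg f (HopfAlgebra.sum_antipode_mul_eq_smul (ℛ k x))
    simpa [hm, h1] using this
  have e4 : toConv (f ∘ₗ 𝐒 ∘ₗ 𝐒) = toConv f := left_inv_eq_right_inv e2 e3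
  exact congrArg (fun f : WithConv (H →ₗ[k] k) => f h) e4

/-- The braiding `(h ⊗ l) ↦ σ⁻¹(l ⊗ h)` opposite to `σ`. -/
noncomputable def oppBraid (σ : (H ⊗[k] H) →ₗ[k] k) : (H ⊗[k] H) →ₗ[k] k :=
  σ ∘ₗ (LinearMap.rTensor H 𝐒) ∘ₗ (TensorProduct.comm k H H).toLinearMap

theorem oppBraid_tmul (σ : (H ⊗[k] H) →ₗ[k] k) (h l : H) :
    oppBraid σ (h ⊗ₜ l) = σ (𝐒 l ⊗ₜ h) := by
  simp [oppBraid]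

theorem oppBraid_mul (σ : (H ⊗[k] H) →ₗ[k] k)
    (hσ1 : ∀ h l m : H, σ ((h * l) ⊗ₜ[k] m) =
      conv (σ ∘ₗ (TensorProduct.mk k H H h)) (σ ∘ₗ (TensorProduct.mk k H H l)) m)
    (h l m : H) : oppBraid σ (h ⊗ₜ[k] (l * m)) =
      conv (oppBraid σ ∘ₗ ((TensorProduct.mk k H H).flip m))
        (oppBraid σ ∘ₗ ((TensorProduct.mk k H H).flip l)) h := by
  rw [oppBraid_tmul, HopfAlgebra.antipode_mul_antidistrib, hσ1, conv_eq_sum, conv_eq_sum]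
  simp [oppBraid_tmul]

theorem oppBraid_ac (σ : (H ⊗[k] H) →ₗ[k] k)
    (hσ1 : ∀ h l m : H, σ ((h * l) ⊗ₜ[k] m) =
      conv (σ ∘ₗ (TensorProduct.mk k H H h)) (σ ∘ₗ (TensorProduct.mk k H H l)) m)
    (hσ3r : ∀ h : H, σ ((1 : H) ⊗ₜ[k] h) = Coalgebra.counit (R := k) h)
    (hσ4 : ∀ h l : H, ac1 σ (h ⊗ₜ[k] l) = ac2 σ (h ⊗ₜ[k] l)) (h l : H) :
    ac1 (oppBraid σ) (h ⊗ₜ l) = ac2 (oppBraid σ) (h ⊗ₜ l) := by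
  let M : WithConv (H ⊗[k] H →ₗ[k] H) := toConv (LinearMap.mul' k H)
  let P : WithConv (H ⊗[k] H →ₗ[k] H) :=
    toConv (LinearMap.mul' k H ∘ₗ (TensorProduct.comm k H H).toLinearMap)
  let s : WithConv (H ⊗[k] H →ₗ[k] H) :=
    toConv (Algebra.linearMap k H ∘ₗ σ ∘ₗ (TensorProduct.comm k H H).toLinearMap)
  let t : WithConv (H ⊗[k] H →ₗ[k] H) := toConv (Algebra.linearMap k H ∘ₗ oppBraid σ)
  have hMs : M * s = s * P := by
    apply WithConv.ofConv_injective
    apply TensorProduct.ext'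
    intro x y
    have := hσ4 y x
    rw [ac1_eq_sum, ac2_eq_sum, Finset.sum_comm] at this
    rw [convMul_tmul_apply, convMul_tmul_apply, ← sub_eq_zero]
    rw [Finset.sum_comm (s := (ℛ k y).index), ← sub_eq_zero] at this
    simpa [M, P, s, Algebra.algebraMap_eq_smul_one] using this
  have hst : s * t = 1 := by
    apply WithConv.ofConv_injective
    apply TensorProduct.ext'
    intro x y
    have h1 := congrArg (fun z => σ (z ⊗ₜ[k] x))
      (HopfAlgebra.sum_mul_antipode_eq_smul (ℛ k y))
    simp only [TensorProduct.sum_tmul, map_sum, hσ1, conv_eq_sum, ← TensorProduct.smul_tmul',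
      map_smul, hσ3r] at h1
    rw [convMul_tmul_apply, Finset.sum_comm]
    have h2 := congrArg (algebraMap k H) h1
    simpa [s, t, oppBraid_tmul, TensorProduct.counit_tmul] using h2
  have hts : t * s = 1 := by
    apply WithConv.ofConv_injective
    apply TensorProduct.ext'
    intro x y
    have h1 := congrArg (fun z => σ (z ⊗ₜ[k] x))
      (HopfAlgebra.sum_antipode_mul_eq_smul (ℛ k y))
    simp only [TensorProduct.sum_tmul, map_sum, hσ1, conv_eq_sum, ← TensorProduct.smul_tmul',
      map_smul, hσ3r] at h1
    rw [convMul_tmul_apply, Finset.sum_comm]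
    have h2 := congrArg (algebraMap k H) h1
    simpa [s, t, oppBraid_tmul, TensorProduct.counit_tmul] using h2
  have key : P * t = t * M := by
    calc P * t = t * s * (P * t) := by rw [hts, one_mul]
      _ = t * (s * P) * t := by noncomm_ring
      _ = t * (M * s) * t := by rw [hMs]
      _ = t * M * (s * t) := by noncomm_ring
      _ = t * M := by rw [hst, mul_one]
  have := congrArg (fun f : WithConv (H ⊗[k] H →ₗ[k] H) => f (h ⊗ₜ l)) key
  simp only [convMul_tmul_apply] at this
  rw [ac1_eq_sum, ac2_eq_sum]
  simpa [M, P, t, Algebra.algebraMap_eq_smul_one] using this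

theorem vF_oppBraid (σ : (H ⊗[k] H) →ₗ[k] k) : vF (oppBraid σ) = uinvF σ := by
  ext h
  rw [vF_eq_sum]
  simp only [uinvF, LinearMap.comp_apply]
  rw [← (ℛ k h).eq]
  simp [oppBraid_tmul]

theorem uF_oppBraid (σ : (H ⊗[k] H) →ₗ[k] k) : uF (oppBraid σ) = vinvF σ := by
  ext h
  rw [uF_eq_sum]
  simp only [vinvF, LinearMap.comp_apply]
  rw [← (ℛ k h).eq]
  simp [oppBraid_tmul]

end Sweedler

/-- In a co-Frobenius coquasitriangular Hopf algebra,
$u^{-1} * v = v * u^{-1} = α * β_a = α * α_a$ in $H^*$. -/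
theorem uinv_conv_v_eq_alpha_conv_beta_a
    (lam : H →ₗ[k] k) (hlam_ne : lam ≠ 0)
    (hlam_int : ∀ f : H →ₗ[k] k, conv f lam = f 1 • lam)
    (a : H) (ha_ne : a ≠ 0) (ha_grp : Coalgebra.comul (R := k) a = a ⊗ₜ[k] a)
    (ha_mod : ∀ h : H, lT lam h = lam h • (𝐒 a))
    (ha_S2 : ∀ h : H, lam (𝐒 (𝐒 h)) = lam (a * h * 𝐒 a))
    (Sinv : H →ₗ[k] H) (hSinv_l : ∀ h : H, Sinv (𝐒 h) = h)
    (hSinv_r : ∀ h : H, 𝐒 (Sinv h) = h)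
    (α : H →ₐ[k] k)
    (hα : ∀ h l : H, lam (l * h) = lam ((chiMap Sinv α.toLinearMap h) * l))
    (σ : (H ⊗[k] H) →ₗ[k] k)
    (hσ1 : ∀ h l m : H, σ ((h * l) ⊗ₜ[k] m) =
      conv (σ ∘ₗ (TensorProduct.mk k H H h)) (σ ∘ₗ (TensorProduct.mk k H H l)) m)
    (hσ2 : ∀ h l m : H, σ (h ⊗ₜ[k] (l * m)) =
      conv (σ ∘ₗ ((TensorProduct.mk k H H).flip m)) (σ ∘ₗ ((TensorProduct.mk k H H).flip l)) h)
    (hσ3l : ∀ h : H, σ (h ⊗ₜ[k] (1 : H)) = Coalgebra.counit (R := k) h)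
    (hσ3r : ∀ h : H, σ ((1 : H) ⊗ₜ[k] h) = Coalgebra.counit (R := k) h)
    (hσ4 : ∀ h l : H, ac1 σ (h ⊗ₜ[k] l) = ac2 σ (h ⊗ₜ[k] l))
    (huinv_r : conv (uF σ) (uinvF σ) = Coalgebra.counit (R := k))
    (huinv_l : conv (uinvF σ) (uF σ) = Coalgebra.counit (R := k))
    (hvinv_r : conv (vF σ) (vinvF σ) = Coalgebra.counit (R := k))
    (hvinv_l : conv (vinvF σ) (vF σ) = Coalgebra.counit (R := k))
    (hS2u : ∀ h : H, 𝐒 (𝐒 h) = sw3 (uF σ) LinearMap.id (uinvF σ) h)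
    (hS2v : ∀ h : H, 𝐒 (𝐒 h) = sw3 (vinvF σ) LinearMap.id (vF σ) h) :
    conv (uinvF σ) (vF σ) = conv (vF σ) (uinvF σ) ∧
      conv (uinvF σ) (vF σ) = conv α.toLinearMap (σ ∘ₗ (TensorProduct.mk k H H a)) ∧
      conv (uinvF σ) (vF σ) =
        conv α.toLinearMap (σ ∘ₗ ((TensorProduct.mk k H H).flip (𝐒 a))) := by
  have ha : IsGroupLikeElem k a := by
    refine ⟨?_, ha_grp⟩
    have h1 := Coalgebra.rTensor_counit_comul (R := k) a
    rw [ha_grp, LinearMap.rTensor_tmul] at h1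
    have h2 := congrArg (TensorProduct.lid k H) h1
    simp only [TensorProduct.lid_tmul, one_smul] at h2
    exact smul_left_injective k ha_ne (by simpa using h2)
  have hr := rT_eq_smul_one lam hlam_int
  have hvL := vF_eq_conv lam hlam_ne hr (𝐒 a) ha_mod Sinv hSinv_r α.toLinearMap hα σ hσ2 hσ4
  have huL := vF_eq_conv lam hlam_ne hr (𝐒 a) ha_mod Sinv hSinv_r α.toLinearMap hα (oppBraid σ)
    (oppBraid_mul σ hσ1) (oppBraid_ac σ hσ1 hσ3r hσ4)
  have hβ : oppBraid σ ∘ₗ ((TensorProduct.mk k H H).flip (𝐒 a)) =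
      σ ∘ₗ (TensorProduct.mk k H H a) := by
    ext h
    simp [oppBraid_tmul, ha.antipode_antipode]
  rw [vF_oppBraid, uF_oppBraid, hβ] at huL
  have hα_comm := convMul_comm_of_antipode_sq
    (σ ∘ₗ ((TensorProduct.mk k H H).flip (𝐒 a))) (uF σ) (uinvF σ) hS2u huinv_l
    (character_antipode_sq _ (by simp [hσ3r, ha.counit_eq_one]) fun x y => by
      simp [hσ1, conv, ha.antipode.comul_eq_tmul_self])
  have hβ_comm := convMul_comm_of_antipode_sq
    (σ ∘ₗ (TensorProduct.mk k H H a)) (vinvF σ) (vF σ) hS2v hvinv_r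
    (character_antipode_sq _ (by simp [hσ3l, ha.counit_eq_one]) fun x y => by
      simp [hσ2, conv, ha_grp, mul_comm])
  have huu : WithConv.toConv (uF σ) * WithConv.toConv (uinvF σ) = 1 :=
    congrArg WithConv.toConv huinv_r
  have huu' : WithConv.toConv (uinvF σ) * WithConv.toConv (uF σ) = 1 :=
    congrArg WithConv.toConv huinv_l
  have hvv : WithConv.toConv (vF σ) * WithConv.toConv (vinvF σ) = 1 :=
    congrArg WithConv.toConv hvinv_r
  have hvv' : WithConv.toConv (vinvF σ) * WithConv.toConv (vF σ) = 1 :=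
    congrArg WithConv.toConv hvinv_l
  have huS : ∀ h : H, uF σ (𝐒 (𝐒 h)) = uF σ h := fun h => by
    rw [hS2u, apply_sw3]
    have : WithConv.toConv (uF σ) * WithConv.toConv (uF σ) * WithConv.toConv (uinvF σ) =
        WithConv.toConv (uF σ) := by
      rw [mul_assoc, huu, mul_one]
    exact congrArg (fun f : WithConv (H →ₗ[k] k) => f h) this
  have huv := convMul_comm_of_antipode_sq (uF σ) (vinvF σ) (vF σ) hS2v hvinv_r huS
  replace hvL : WithConv.toConv (vF σ) = WithConv.toConv α.toLinearMap *
      (WithConv.toConv (uF σ) * WithConv.toConv (σ ∘ₗ ((TensorProduct.mk k H H).flip (𝐒 a)))) :=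
    congrArg WithConv.toConv hvL
  replace huL : WithConv.toConv (uinvF σ) = WithConv.toConv α.toLinearMap *
      (WithConv.toConv (vinvF σ) * WithConv.toConv (σ ∘ₗ (TensorProduct.mk k H H a))) :=
    congrArg WithConv.toConv huL
  have hvu : WithConv.toConv (vF σ) * WithConv.toConv (uF σ) =
      WithConv.toConv (uF σ) * WithConv.toConv (vF σ) := by
    calc _ = WithConv.toConv (vF σ) * (WithConv.toConv (uF σ) * WithConv.toConv (vinvF σ)) *
          WithConv.toConv (vF σ) := by rw [mul_assoc, mul_assoc, hvv', mul_one]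
      _ = _ := by rw [huv, ← mul_assoc, hvv, one_mul]
  have hcomm : WithConv.toConv (uinvF σ) * WithConv.toConv (vF σ) =
      WithConv.toConv (vF σ) * WithConv.toConv (uinvF σ) := by
    calc _ = WithConv.toConv (uinvF σ) * (WithConv.toConv (vF σ) * WithConv.toConv (uF σ)) *
          WithConv.toConv (uinvF σ) := by rw [mul_assoc, mul_assoc, huu, mul_one]
      _ = _ := by rw [hvu, ← mul_assoc, huu', one_mul]
  have hαβ : WithConv.toConv (uinvF σ) * WithConv.toConv (vF σ) =
      WithConv.toConv α.toLinearMap * WithConv.toConv (σ ∘ₗ (TensorProduct.mk k H H a)) := by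
    rw [huL, ← hβ_comm, mul_assoc, mul_assoc, hvv', mul_one]
  have hαα : WithConv.toConv (vF σ) * WithConv.toConv (uinvF σ) =
      WithConv.toConv α.toLinearMap *
        WithConv.toConv (σ ∘ₗ ((TensorProduct.mk k H H).flip (𝐒 a))) := by
    rw [hvL, ← hα_comm, mul_assoc, mul_assoc, huu, mul_one]
  exact ⟨congrArg WithConv.ofConv hcomm, congrArg WithConv.ofConv hαβ,
    congrArg WithConv.ofConv (hcomm.trans hαα)⟩
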